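/- Every W-logic WL among the fourteen systems enjoys Craig interpolation: for all formulas A and B, if WL ⊢ A → B, then there exists a formula C such that WL ⊢ A → C, WL ⊢ C → B, and var(C) ⊆ var(A) ∩ var(B). -/

import Mathlib

set_option autoImplicit false

/-- Formulas of the propositional modal language:
`A ::= p | ⊥ | A∧A | A∨A | A→A | □A | ◇A`. -/
inductive Formula : Type
  | var : ℕ → Formula
  | bot : Formula
  | and : Formula → Formula → Formula
  | or : Formula → Formula → Formula
  | imp : Formula → Formula → Formula
  | box : Formula → Formula
  | dia : Formula → Formula
  deriving DecidableEq

/-- `¬A := A → ⊥`. -/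
def Formula.neg (A : Formula) : Formula := A.imp Formula.bot

/-- `⊤ := ⊥ → ⊥`. -/
def Formula.top : Formula := Formula.bot.imp Formula.bot

/-- A specification of which additional modal axioms a logic has:
`N` (□⊤ / N-condition), `C` (C_□ together with K_◇ in W-logics),
`P` (P_□ classically / P_◇ in W-logics), `D` (□A→◇A), `T` (T_□, and T_◇ in W-logics). -/
structure LogicSpec where
  hasN : Bool := false
  hasC : Bool := false
  hasP : Bool := false
  hasD : Bool := false
  hasT : Bool := false

/-- The names of the fourteen systems. -/
inductive LName : Type
  | M | MN | MC | K | MP | MNP | MD | MND | MCD | KD | MT | MNT | MCT | KT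

/-- The axiom flags of the fourteen classical modal logics. -/
def cSpec : LName → LogicSpec
  | .M   => {}
  | .MN  => { hasN := true }
  | .MC  => { hasC := true }
  | .K   => { hasN := true, hasC := true }
  | .MP  => { hasP := true }
  | .MNP => { hasN := true, hasP := true }
  | .MD  => { hasD := true }
  | .MND => { hasN := true, hasD := true }
  | .MCD => { hasC := true, hasD := true }
  | .KD  => { hasN := true, hasC := true, hasD := true }
  | .MT  => { hasT := true }
  | .MNT => { hasN := true, hasT := true }
  | .MCT => { hasC := true, hasT := true }
  | .KT  => { hasN := true, hasC := true, hasT := true }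

/-- The axiom flags of the fourteen W-logics (WMD and WMCD include the axiom P_◇ explicitly). -/
def wSpec : LName → LogicSpec
  | .MD  => { hasP := true, hasD := true }
  | .MCD => { hasC := true, hasP := true, hasD := true }
  | n    => cSpec n

/-- Hilbert-style provability in the W-logic determined by the flags `S`:
intuitionistic propositional logic plus dual∧, the monotonicity rules M_□ and M_◇,
and, according to the flags, N_□, C_□ together with K_◇, P_◇, D, T_□ together with T_◇. -/
inductive WProof (S : LogicSpec) : Formula → Prop
  | ax1 (A B : Formula) : WProof S (A.imp (B.imp A))
  | ax2 (A B C : Formula) : WProof S ((A.imp (B.imp C)).imp ((A.imp B).imp (A.imp C)))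
  | andI (A B : Formula) : WProof S (A.imp (B.imp (A.and B)))
  | andE1 (A B : Formula) : WProof S ((A.and B).imp A)
  | andE2 (A B : Formula) : WProof S ((A.and B).imp B)
  | orI1 (A B : Formula) : WProof S (A.imp (A.or B))
  | orI2 (A B : Formula) : WProof S (B.imp (A.or B))
  | orE (A B C : Formula) : WProof S ((A.imp C).imp ((B.imp C).imp ((A.or B).imp C)))
  | botE (A : Formula) : WProof S (Formula.bot.imp A)
  | mp {A B : Formula} : WProof S (A.imp B) → WProof S A → WProof S B
  | dualAnd (A : Formula) : WProof S (((Formula.box A).and (Formula.dia A.neg)).neg)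
  | monBox {A B : Formula} : WProof S (A.imp B) → WProof S ((Formula.box A).imp (Formula.box B))
  | monDia {A B : Formula} : WProof S (A.imp B) → WProof S ((Formula.dia A).imp (Formula.dia B))
  | nBox : S.hasN = true → WProof S (Formula.box Formula.top)
  | cBox (A B : Formula) : S.hasC = true →
      WProof S (((Formula.box A).and (Formula.box B)).imp (Formula.box (A.and B)))
  | kDia (A B : Formula) : S.hasC = true →
      WProof S ((Formula.box (A.imp B)).imp ((Formula.dia A).imp (Formula.dia B)))
  | pDia : S.hasP = true → WProof S (Formula.dia Formula.top)
  | dAx (A : Formula) : S.hasD = true → WProof S ((Formula.box A).imp (Formula.dia A))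
  | tBox (A : Formula) : S.hasT = true → WProof S ((Formula.box A).imp A)
  | tDia (A : Formula) : S.hasT = true → WProof S (A.imp (Formula.dia A))

/-- `var(A) := {⊥} ∪ {p : p is a propositional variable occurring in A}`,
as a set of formulas. -/
def varOf : Formula → Set Formula
  | Formula.var p => {Formula.bot, Formula.var p}
  | Formula.bot => {Formula.bot}
  | Formula.and A B => varOf A ∪ varOf B
  | Formula.or A B => varOf A ∪ varOf B
  | Formula.imp A B => varOf A ∪ varOf B
  | Formula.box A => varOf A
  | Formula.dia A => varOf A

/-- `var(Γ)` for a multiset of formulas (always containing ⊥). -/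
def varM (Γ : Multiset Formula) : Set Formula :=
  {x | x = Formula.bot ∨ ∃ B ∈ Γ, x ∈ varOf B}

/-- `var(Δ)` for the succedent of a single-succedent sequent. -/
def varO : Option Formula → Set Formula
  | none => {Formula.bot}
  | some A => varOf A

namespace Formula

/-- The formulas `□A` for `A ∈ Δ` all belong to `Γ`. -/
abbrev BoxIn (Δ Γ : List Formula) : Prop := ∀ A ∈ Δ, A.box ∈ Γ

end Formula

open Formula

/-- A box may be inferred from `n` boxed hypotheses. -/
def LogicSpec.BoxArity (S : LogicSpec) (n : ℕ) : Prop :=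
  n = 1 ∨ (n = 0 ∧ S.hasN = true) ∨ (2 ≤ n ∧ S.hasC = true)

/-- A diamond may be inferred from a diamond and `n` boxed hypotheses. -/
def LogicSpec.DiaArity (S : LogicSpec) (n : ℕ) : Prop :=
  n = 0 ∨ S.hasC = true

/-- A diamond may be inferred from `n` boxed hypotheses. -/
def LogicSpec.SerialArity (S : LogicSpec) (n : ℕ) : Prop :=
  (n = 0 ∧ (S.hasP = true ∨ S.hasD = true)) ∨ (n = 1 ∧ S.hasD = true) ∨
    (S.hasC = true ∧ S.hasD = true)

/-- `n` jointly inconsistent formulas may not all be boxed. -/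
def LogicSpec.ConsArity (S : LogicSpec) (n : ℕ) : Prop :=
  (n ≤ 1 ∧ (S.hasP = true ∨ S.hasD = true)) ∨ (n ≤ 2 ∧ S.hasD = true) ∨
    (S.hasC = true ∧ S.hasD = true)

/-- The closure conditions on the flags which hold for the fourteen systems. -/
structure LogicSpec.Regular (S : LogicSpec) : Prop where
  serial : S.hasD = true → S.hasP = true ∨ S.hasN = true
  normal : S.hasC = true → S.hasP = true → S.hasD = true

theorem wSpec_regular (L : LName) : (wSpec L).Regular := by
  cases L <;> constructor <;> simp [wSpec, cSpec]

/-- A cut-free single-succedent sequent calculus for the W-logics. Contexts are cumulative, and an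
empty succedent is represented by `⊥`. -/
inductive Der (S : LogicSpec) : List Formula → Formula → Prop
  | ax {Γ : List Formula} {A : Formula} : A ∈ Γ → Der S Γ A
  | botL {Γ : List Formula} {D : Formula} : bot ∈ Γ → Der S Γ D
  | andR {Γ : List Formula} {A B : Formula} : Der S Γ A → Der S Γ B → Der S Γ (A.and B)
  | andL {Γ : List Formula} {A B D : Formula} : A.and B ∈ Γ → Der S (A :: B :: Γ) D → Der S Γ D
  | orR1 {Γ : List Formula} {A B : Formula} : Der S Γ A → Der S Γ (A.or B)
  | orR2 {Γ : List Formula} {A B : Formula} : Der S Γ B → Der S Γ (A.or B)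
  | orL {Γ : List Formula} {A B D : Formula} :
      A.or B ∈ Γ → Der S (A :: Γ) D → Der S (B :: Γ) D → Der S Γ D
  | impR {Γ : List Formula} {A B : Formula} : Der S (A :: Γ) B → Der S Γ (A.imp B)
  | impL {Γ : List Formula} {A B D : Formula} :
      A.imp B ∈ Γ → Der S Γ A → Der S (B :: Γ) D → Der S Γ D
  | box {Γ Δ : List Formula} {C : Formula} :
      S.BoxArity Δ.length → BoxIn Δ Γ → Der S Δ C → Der S Γ C.box
  | dia {Γ Δ : List Formula} {B C : Formula} :
      S.DiaArity Δ.length → BoxIn Δ Γ → B.dia ∈ Γ → Der S (B :: Δ) C →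
      Der S Γ C.dia
  | dual {Γ Δ : List Formula} {B D : Formula} :
      S.BoxArity Δ.length → BoxIn Δ Γ → B.dia ∈ Γ → Der S (B :: Δ) bot → Der S Γ D
  | serial {Γ Δ : List Formula} {C : Formula} :
      S.SerialArity Δ.length → BoxIn Δ Γ → Der S Δ C → Der S Γ C.dia
  | cons {Γ Δ : List Formula} {D : Formula} :
      S.ConsArity Δ.length → BoxIn Δ Γ → Der S Δ bot → Der S Γ D
  | boxT {Γ : List Formula} {A D : Formula} :
      S.hasT = true → A.box ∈ Γ → Der S (A :: Γ) D → Der S Γ D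
  | diaT {Γ : List Formula} {A : Formula} : S.hasT = true → Der S Γ A → Der S Γ A.dia

namespace Der

variable {S : LogicSpec}

theorem weaken {Γ : List Formula} {D : Formula} (h : Der S Γ D) :
    ∀ {Γ' : List Formula}, Γ ⊆ Γ' → Der S Γ' D := by
  induction h with
  | ax h => exact fun s => .ax (s h)
  | botL h => exact fun s => .botL (s h)
  | andR _ _ ih1 ih2 => exact fun s => .andR (ih1 s) (ih2 s)
  | andL h _ ih =>
    exact fun s => .andL (s h) (ih (List.cons_subset_cons _ (List.cons_subset_cons _ s)))
  | orR1 _ ih => exact fun s => .orR1 (ih s)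
  | orR2 _ ih => exact fun s => .orR2 (ih s)
  | orL h _ _ ih1 ih2 =>
    exact fun s => .orL (s h) (ih1 (List.cons_subset_cons _ s)) (ih2 (List.cons_subset_cons _ s))
  | impR _ ih => exact fun s => .impR (ih (List.cons_subset_cons _ s))
  | impL h _ _ ih1 ih2 => exact fun s => .impL (s h) (ih1 s) (ih2 (List.cons_subset_cons _ s))
  | box h1 h2 h3 _ => exact fun s => .box h1 (fun A hA => s (h2 A hA)) h3
  | dia h1 h2 h h3 _ => exact fun s => .dia h1 (fun A hA => s (h2 A hA)) (s h) h3
  | dual h1 h2 h h3 _ => exact fun s => .dual h1 (fun A hA => s (h2 A hA)) (s h) h3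
  | serial h1 h2 h3 _ => exact fun s => .serial h1 (fun A hA => s (h2 A hA)) h3
  | cons h1 h2 h3 _ => exact fun s => .cons h1 (fun A hA => s (h2 A hA)) h3
  | boxT h1 h2 _ ih => exact fun s => .boxT h1 (s h2) (ih (List.cons_subset_cons _ s))
  | diaT h _ ih => exact fun s => .diaT h (ih s)

theorem boxes_T (hT : S.hasT = true) {Γ Δ : List Formula} {D : Formula} (hb : BoxIn Δ Γ)
    (h : Der S (Δ ++ Γ) D) : Der S Γ D := by
  induction Δ with
  | nil => exact h
  | cons A Δ ih =>
    exact ih (fun B hB => hb B (List.mem_cons_of_mem _ hB))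
      (.boxT hT (List.mem_append_right _ (hb A List.mem_cons_self)) h)

/-- Cut on the formula `A` is admissible. -/
def CutAdm (S : LogicSpec) (A : Formula) : Prop :=
  ∀ ⦃Γ : List Formula⦄ ⦃D : Formula⦄, Der S Γ A → Der S (A :: Γ) D → Der S Γ D

/-- Every left rule with principal formula `X` is admissible without `X` in any context
extending `Γ₀`; for a box, `X` is moreover the conclusion of the right rule. -/
structure Reducible (S : LogicSpec) (Γ₀ : List Formula) (X : Formula) : Prop where
  der : Der S Γ₀ X
  bot : X ≠ bot
  and {A B} : X = Formula.and A B → ∀ {Γ D}, Γ₀ ⊆ Γ → Der S (A :: B :: Γ) D → Der S Γ D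
  or {A B} : X = Formula.or A B →
    ∀ {Γ D}, Γ₀ ⊆ Γ → Der S (A :: Γ) D → Der S (B :: Γ) D → Der S Γ D
  imp {A B} : X = Formula.imp A B →
    ∀ {Γ D}, Γ₀ ⊆ Γ → Der S Γ A → Der S (B :: Γ) D → Der S Γ D
  box {A} : X = Formula.box A →
    CutAdm S A ∧ ∃ Δ, S.BoxArity Δ.length ∧ BoxIn Δ Γ₀ ∧ Der S Δ A
  dia {A} : X = Formula.dia A → ∀ {Γ Δ C}, Γ₀ ⊆ Γ → S.DiaArity Δ.length → BoxIn Δ Γ →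
    Der S (A :: Δ) C → Der S Γ C.dia
  dual {A} : X = Formula.dia A → ∀ {Γ Δ D}, Γ₀ ⊆ Γ → S.BoxArity Δ.length → BoxIn Δ Γ →
    Der S (A :: Δ) Formula.bot → Der S Γ D

theorem boxIn_cons {Δ Γ : List Formula} {X : Formula} (h : BoxIn Δ (X :: Γ)) :
    BoxIn Δ Γ ∨ ∃ A Δ', X = A.box ∧ Δ ⊆ A :: Δ' ∧ Δ'.length < Δ.length ∧ BoxIn Δ' Γ := by
  by_cases hX : ∃ A ∈ Δ, A.box = X
  · obtain ⟨A, hA, rfl⟩ := hX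
    refine .inr ⟨A, Δ.filter (· ≠ A), rfl, fun B hB => ?_, ?_, fun B hB => ?_⟩
    · by_cases hBA : B = A <;> simp [hB, hBA]
    · exact List.length_filter_lt_length_iff_exists.2 ⟨A, hA, by simp⟩
    · have hB' := List.mem_filter.1 hB
      have := h B hB'.1
      grind
  · exact .inl fun A hA => (List.mem_cons.1 (h A hA)).resolve_left fun e => hX ⟨A, hA, e⟩

/-- The boxed hypotheses of a modal rule can avoid a reducible formula `X`. -/
theorem Reducible.boxIn {Γ₀ : List Formula} {X : Formula} (hX : Reducible S Γ₀ X)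
    {Γ Δ : List Formula} (hΓ : Γ₀ ⊆ Γ) (h : BoxIn Δ (X :: Γ)) :
    ∃ Δ', BoxIn Δ' Γ ∧ (∀ {Θ D}, Der S (Θ ++ Δ) D → Der S (Θ ++ Δ') D) ∧
      (Δ'.length = Δ.length ∨ ∃ m n, Δ'.length = m + n ∧ m < Δ.length ∧ S.BoxArity n) := by
  obtain h | ⟨A, Δ', rfl, hs, hl, hb⟩ := boxIn_cons h
  · exact ⟨Δ, h, id, .inl rfl⟩
  · obtain ⟨hc, Δ₁, h1, h2, h3⟩ := hX.box rfl
    refine ⟨Δ' ++ Δ₁, ?_, fun {Θ D} hD => ?_, .inr ⟨_, _, List.length_append, hl, h1⟩⟩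
    · intro B hB
      exact (List.mem_append.1 hB).elim (hb B) fun hB => hΓ (h2 B hB)
    · refine hc (h3.weaken (by intro; simp +contextual)) (hD.weaken fun B hB => ?_)
      have := @hs B
      grind

theorem _root_.LogicSpec.BoxArity.comp {k m n : ℕ} (h : S.BoxArity k) (hm : m < k)
    (hn : S.BoxArity n) : S.BoxArity (m + n) := by
  unfold LogicSpec.BoxArity at *
  grind

theorem _root_.LogicSpec.DiaArity.comp {k m n : ℕ} (h : S.DiaArity k) (hm : m < k) :
    S.DiaArity (m + n) := by
  unfold LogicSpec.DiaArity at *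
  grind

theorem _root_.LogicSpec.SerialArity.comp {k m n : ℕ} (h : S.SerialArity k) (hm : m < k)
    (hn : S.BoxArity n) : S.SerialArity (m + n) := by
  unfold LogicSpec.BoxArity LogicSpec.SerialArity at *
  grind

theorem _root_.LogicSpec.ConsArity.comp (hS : S.Regular) {k m n : ℕ} (h : S.ConsArity k)
    (hm : m < k) (hn : S.BoxArity n) : S.ConsArity (m + n) := by
  have := hS.normal
  unfold LogicSpec.BoxArity LogicSpec.ConsArity at *
  grind

theorem _root_.LogicSpec.DiaArity.add {m n : ℕ} (h : S.DiaArity m) (hn : S.DiaArity n) :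
    S.DiaArity (m + n) := by
  unfold LogicSpec.DiaArity at *
  grind

theorem _root_.LogicSpec.DiaArity.add_box {m n : ℕ} (h : S.DiaArity m) (hn : S.BoxArity n) :
    S.BoxArity (m + n) := by
  unfold LogicSpec.DiaArity LogicSpec.BoxArity at *
  grind

theorem _root_.LogicSpec.SerialArity.add_dia (hS : S.Regular) {m n : ℕ} (h : S.SerialArity m)
    (hn : S.DiaArity n) : S.SerialArity (m + n) := by
  have := hS.normal
  unfold LogicSpec.DiaArity LogicSpec.SerialArity at *
  grind

theorem _root_.LogicSpec.SerialArity.add_box (hS : S.Regular) {m n : ℕ} (h : S.SerialArity m)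
    (hn : S.BoxArity n) : S.ConsArity (m + n) := by
  have := hS.normal
  unfold LogicSpec.BoxArity LogicSpec.SerialArity LogicSpec.ConsArity at *
  grind

theorem Reducible.cut (hS : S.Regular) {Γ₀ : List Formula} {X : Formula}
    (hX : Reducible S Γ₀ X) {Δ : List Formula} {D : Formula} (h : Der S Δ D) :
    ∀ {Γ}, Γ₀ ⊆ Γ → Δ ⊆ X :: Γ → Der S Γ D := by
  have up : ∀ {Γ Γ' : List Formula} {A : Formula}, Γ' ⊆ X :: Γ → A :: Γ' ⊆ X :: A :: Γ :=
    fun s B hB => by have := @s B; grind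
  have ex : ∀ {Γ : List Formula} {A : Formula}, Γ₀ ⊆ Γ → Γ₀ ⊆ A :: Γ :=
    fun s => List.subset_cons_of_subset _ s
  induction h with
  | ax h =>
    intro Γ s t
    obtain rfl | h := List.mem_cons.1 (t h)
    · exact hX.der.weaken s
    · exact .ax h
  | botL h =>
    intro Γ s t
    exact .botL ((List.mem_cons.1 (t h)).resolve_left fun e => hX.bot e.symm)
  | andR _ _ ih1 ih2 => exact fun s t => .andR (ih1 s t) (ih2 s t)
  | andL h _ ih =>
    intro Γ s t
    have ih := ih (ex (ex s)) (up (up t))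
    obtain e | h := List.mem_cons.1 (t h)
    · exact hX.and e.symm s ih
    · exact .andL h ih
  | orR1 _ ih => exact fun s t => .orR1 (ih s t)
  | orR2 _ ih => exact fun s t => .orR2 (ih s t)
  | orL h _ _ ih1 ih2 =>
    intro Γ s t
    have ih1 := ih1 (ex s) (up t)
    have ih2 := ih2 (ex s) (up t)
    obtain e | h := List.mem_cons.1 (t h)
    · exact hX.or e.symm s ih1 ih2
    · exact .orL h ih1 ih2
  | impR _ ih => exact fun s t => .impR (ih (ex s) (up t))
  | impL h _ _ ih1 ih2 =>
    intro Γ s t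
    have ih1 := ih1 s t
    have ih2 := ih2 (ex s) (up t)
    obtain e | h := List.mem_cons.1 (t h)
    · exact hX.imp e.symm s ih1 ih2
    · exact .impL h ih1 ih2
  | box h1 h2 h3 _ =>
    intro Γ s t
    obtain ⟨Δ', hb, hd, hl⟩ := hX.boxIn s fun A hA => t (h2 A hA)
    refine .box ?_ hb (hd (Θ := []) h3)
    obtain hl | ⟨m, n, hl, hm, hn⟩ := hl
    · rwa [hl]
    · exact hl ▸ h1.comp hm hn
  | dia h1 h2 h h3 _ =>
    intro Γ s t
    obtain ⟨Δ', hb, hd, hl⟩ := hX.boxIn s fun A hA => t (h2 A hA)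
    have h3 := hd (Θ := [_]) h3
    have ha : S.DiaArity Δ'.length := by
      obtain hl | ⟨m, n, hl, hm, hn⟩ := hl
      · rwa [hl]
      · exact hl ▸ h1.comp hm
    obtain e | h := List.mem_cons.1 (t h)
    · exact hX.dia e.symm s ha hb h3
    · exact .dia ha hb h h3
  | dual h1 h2 h h3 _ =>
    intro Γ s t
    obtain ⟨Δ', hb, hd, hl⟩ := hX.boxIn s fun A hA => t (h2 A hA)
    have h3 := hd (Θ := [_]) h3
    have ha : S.BoxArity Δ'.length := by
      obtain hl | ⟨m, n, hl, hm, hn⟩ := hl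
      · rwa [hl]
      · exact hl ▸ h1.comp hm hn
    obtain e | h := List.mem_cons.1 (t h)
    · exact hX.dual e.symm s ha hb h3
    · exact .dual ha hb h h3
  | serial h1 h2 h3 _ =>
    intro Γ s t
    obtain ⟨Δ', hb, hd, hl⟩ := hX.boxIn s fun A hA => t (h2 A hA)
    refine .serial ?_ hb (hd (Θ := []) h3)
    obtain hl | ⟨m, n, hl, hm, hn⟩ := hl
    · rwa [hl]
    · exact hl ▸ h1.comp hm hn
  | cons h1 h2 h3 _ =>
    intro Γ s t
    obtain ⟨Δ', hb, hd, hl⟩ := hX.boxIn s fun A hA => t (h2 A hA)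
    refine .cons ?_ hb (hd (Θ := []) h3)
    obtain hl | ⟨m, n, hl, hm, hn⟩ := hl
    · rwa [hl]
    · exact hl ▸ h1.comp hS hm hn
  | boxT h1 h2 _ ih =>
    intro Γ s t
    have ih := ih (ex s) (up t)
    obtain e | h := List.mem_cons.1 (t h2)
    · obtain ⟨hc, Δ, -, h4, h5⟩ := hX.box e.symm
      exact hc (boxes_T h1 (fun B hB => s (h4 B hB)) (h5.weaken (List.subset_append_left _ _))) ih
    · exact .boxT h1 h ih
  | diaT h _ ih => exact fun s t => .diaT h (ih s t)

theorem boxIn_append {Δ Δ' Γ : List Formula} (h : BoxIn Δ Γ) (h' : BoxIn Δ' Γ) :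
    BoxIn (Δ ++ Δ') Γ := fun A hA => (List.mem_append.1 hA).elim (h A) (h' A)

theorem boxIn_mono {Δ Γ Γ' : List Formula} (h : BoxIn Δ Γ) (s : Γ ⊆ Γ') : BoxIn Δ Γ' :=
  fun A hA => s (h A hA)

theorem CutAdm.append {A : Formula} (hA : CutAdm S A) {Γ Δ : List Formula} {D : Formula}
    (h : Der S Γ A) (h' : Der S (A :: Δ) D) : Der S (Γ ++ Δ) D :=
  hA (h.weaken (List.subset_append_left _ _))
    (h'.weaken (List.cons_subset_cons _ (List.subset_append_right _ _)))

theorem explosion {Γ : List Formula} (h : Der S Γ bot) (D : Formula) : Der S Γ D := by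
  generalize e : bot = X at h
  induction h with
  | ax h => exact .botL (e ▸ h)
  | botL h => exact .botL h
  | andL h _ ih => exact .andL h (ih e)
  | orL h _ _ ih1 ih2 => exact .orL h (ih1 e) (ih2 e)
  | impL h h1 _ _ ih => exact .impL h h1 (ih e)
  | dual h1 h2 h h3 _ => exact .dual h1 h2 h h3
  | cons h1 h2 h3 _ => exact .cons h1 h2 h3
  | boxT hT h _ ih => exact .boxT hT h (ih e)
  | _ => cases e

theorem cutAdm_of_lt (hS : S.Regular) {X : Formula} {Γ : List Formula} (h : Der S Γ X) :
    (∀ Y, sizeOf Y < sizeOf X → CutAdm S Y) →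
      ∀ {Γ' : List Formula} {D : Formula}, Γ ⊆ Γ' → Der S (X :: Γ') D → Der S Γ' D := by
  have ex : ∀ {Γ : List Formula} {X A D : Formula}, Der S (X :: Γ) D → Der S (X :: A :: Γ) D :=
    fun h => h.weaken (List.cons_subset_cons _ (List.subset_cons_self _ _))
  induction h with
  | ax h => exact fun _ Γ' D s hd => hd.weaken (List.cons_subset.2 ⟨s h, List.Subset.refl _⟩)
  | botL h => exact fun _ Γ' D s _ => .botL (s h)
  | andL h _ ih =>
    exact fun c Γ' D s hd => .andL (s h)
      (ih c (List.cons_subset_cons _ (List.cons_subset_cons _ s)) (ex (ex hd)))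
  | orL h _ _ ih1 ih2 =>
    exact fun c Γ' D s hd => .orL (s h) (ih1 c (List.cons_subset_cons _ s) (ex hd))
      (ih2 c (List.cons_subset_cons _ s) (ex hd))
  | impL h h1 _ _ ih =>
    exact fun c Γ' D s hd => .impL (s h) (h1.weaken s) (ih c (List.cons_subset_cons _ s) (ex hd))
  | dual h1 h2 h h3 _ => exact fun _ Γ' D s _ => .dual h1 (boxIn_mono h2 s) (s h) h3
  | cons h1 h2 h3 _ => exact fun _ Γ' D s _ => .cons h1 (boxIn_mono h2 s) h3
  | boxT hT h _ ih =>
    exact fun c Γ' D s hd => .boxT hT (s h) (ih c (List.cons_subset_cons _ s) (ex hd))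
  | @andR Γ A B h1 h2 _ _ =>
    intro c Γ' D s hd
    have cA := c A (by simp +arith)
    have cB := c B (by simp +arith)
    have hR : Reducible S Γ (A.and B) :=
      { der := .andR h1 h2
        bot := nofun
        or := nofun
        imp := nofun
        box := nofun
        dia := nofun
        dual := nofun
        and := by
          rintro _ _ ⟨⟩ Γ D s h
          exact cB (h2.weaken s) (cA (h1.weaken (List.subset_cons_of_subset _ s)) h) }
    exact hR.cut hS hd s (List.Subset.refl _)
  | @orR1 Γ A B h _ =>
    intro c Γ' D s hd
    have cA := c A (by simp +arith)
    have hR : Reducible S Γ (A.or B) :=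
      { der := .orR1 h
        bot := nofun
        and := nofun
        imp := nofun
        box := nofun
        dia := nofun
        dual := nofun
        or := by
          rintro _ _ ⟨⟩ Γ D s h1 _
          exact cA (h.weaken s) h1 }
    exact hR.cut hS hd s (List.Subset.refl _)
  | @orR2 Γ A B h _ =>
    intro c Γ' D s hd
    have cB := c B (by simp +arith)
    have hR : Reducible S Γ (A.or B) :=
      { der := .orR2 h
        bot := nofun
        and := nofun
        imp := nofun
        box := nofun
        dia := nofun
        dual := nofun
        or := by
          rintro _ _ ⟨⟩ Γ D s _ h2
          exact cB (h.weaken s) h2 }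
    exact hR.cut hS hd s (List.Subset.refl _)
  | @impR Γ A B h _ =>
    intro c Γ' D s hd
    have cA := c A (by simp +arith)
    have cB := c B (by simp +arith)
    have hR : Reducible S Γ (A.imp B) :=
      { der := .impR h
        bot := nofun
        and := nofun
        or := nofun
        box := nofun
        dia := nofun
        dual := nofun
        imp := by
          rintro _ _ ⟨⟩ Γ D s h1 h2
          exact cB (cA h1 (h.weaken (List.cons_subset_cons _ s))) h2 }
    exact hR.cut hS hd s (List.Subset.refl _)
  | @box Γ Δ A h1 h2 h3 _ =>
    intro c Γ' D s hd
    have cA := c A (by simp)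
    have hR : Reducible S Γ A.box :=
      { der := .box h1 h2 h3
        bot := nofun
        and := nofun
        or := nofun
        imp := nofun
        dia := nofun
        dual := nofun
        box := by
          rintro _ ⟨⟩
          exact ⟨cA, Δ, h1, h2, h3⟩ }
    exact hR.cut hS hd s (List.Subset.refl _)
  | @dia Γ Δ B A h1 h2 h3 h4 _ =>
    intro c Γ' D s hd
    have cA := c A (by simp)
    have hR : Reducible S Γ A.dia :=
      { der := .dia h1 h2 h3 h4
        bot := nofun
        and := nofun
        or := nofun
        imp := nofun
        box := nofun
        dia := by
          rintro _ ⟨⟩ Γ Δ' C s h5 h6 h7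
          exact .dia (List.length_append ▸ h1.add h5) (boxIn_append (boxIn_mono h2 s) h6) (s h3)
            (cA.append h4 h7)
        dual := by
          rintro _ ⟨⟩ Γ Δ' C s h5 h6 h7
          exact .dual (List.length_append ▸ h1.add_box h5) (boxIn_append (boxIn_mono h2 s) h6)
            (s h3) (cA.append h4 h7) }
    exact hR.cut hS hd s (List.Subset.refl _)
  | @serial Γ Δ A h1 h2 h4 _ =>
    intro c Γ' D s hd
    have cA := c A (by simp)
    have hR : Reducible S Γ A.dia :=
      { der := .serial h1 h2 h4
        bot := nofun
        and := nofun
        or := nofun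
        imp := nofun
        box := nofun
        dia := by
          rintro _ ⟨⟩ Γ Δ' C s h5 h6 h7
          exact .serial (List.length_append ▸ h1.add_dia hS h5)
            (boxIn_append (boxIn_mono h2 s) h6) (cA.append h4 h7)
        dual := by
          rintro _ ⟨⟩ Γ Δ' C s h5 h6 h7
          exact .cons (List.length_append ▸ h1.add_box hS h5)
            (boxIn_append (boxIn_mono h2 s) h6) (cA.append h4 h7) }
    exact hR.cut hS hd s (List.Subset.refl _)
  | @diaT Γ A hT h _ =>
    intro c Γ' D s hd
    have cA := c A (by simp)
    have app : ∀ {Γ Γ' Δ : List Formula} {D : Formula}, Γ ⊆ Γ' → Der S (Γ ++ Δ) D →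
        Der S (Δ ++ Γ') D := fun s h => h.weaken fun B hB => by have := @s B; grind
    have hR : Reducible S Γ A.dia :=
      { der := .diaT hT h
        bot := nofun
        and := nofun
        or := nofun
        imp := nofun
        box := nofun
        dia := by
          rintro _ ⟨⟩ Γ Δ' C s _ h6 h7
          exact .diaT hT (boxes_T hT h6 (app s (cA.append h h7)))
        dual := by
          rintro _ ⟨⟩ Γ Δ' C s _ h6 h7
          exact explosion (boxes_T hT h6 (app s (cA.append h h7))) _ }
    exact hR.cut hS hd s (List.Subset.refl _)

theorem cut (hS : S.Regular) {Γ : List Formula} {A D : Formula} (h : Der S Γ A)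
    (h' : Der S (A :: Γ) D) : Der S Γ D :=
  have adm : ∀ n A, sizeOf A = n → CutAdm S A := fun n =>
    n.strong_induction_on fun _ ih _ e _ _ h h' =>
      cutAdm_of_lt hS h (fun Y hY => ih _ (e ▸ hY) Y rfl) (List.Subset.refl _) h'
  adm _ A rfl h h'

theorem mp (hS : S.Regular) {Γ : List Formula} {A B : Formula} (h : Der S Γ (A.imp B))
    (h' : Der S Γ A) : Der S Γ B :=
  cut hS h (.impL List.mem_cons_self (h'.weaken (List.subset_cons_self _ _))
    (.ax List.mem_cons_self))

theorem of_wProof (hS : S.Regular) {A : Formula} (h : WProof S A) : Der S [] A := by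
  have dd : ∀ {A B}, Der S [] (A.imp B) → Der S [A] B := fun h =>
    mp hS (h.weaken (List.nil_subset _)) (.ax List.mem_cons_self)
  induction h with
  | ax1 A B => exact .impR (.impR (.ax (by simp)))
  | ax2 A B C =>
    refine .impR (.impR (.impR (mp hS (A := B) (mp hS (A := A) ?_ ?_) (mp hS (A := A) ?_ ?_)))) <;>
      exact .ax (by simp)
  | andI A B => exact .impR (.impR (.andR (.ax (by simp)) (.ax (by simp))))
  | andE1 A B => exact .impR (.andL List.mem_cons_self (.ax (by simp)))
  | andE2 A B => exact .impR (.andL List.mem_cons_self (.ax (by simp)))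
  | orI1 A B => exact .impR (.orR1 (.ax (by simp)))
  | orI2 A B => exact .impR (.orR2 (.ax (by simp)))
  | orE A B C =>
    refine .impR (.impR (.impR (.orL (A := A) (B := B) (by simp) ?_ ?_)))
    · exact mp hS (A := A) (.ax (by simp)) (.ax (by simp))
    · exact mp hS (A := B) (.ax (by simp)) (.ax (by simp))
  | botE A => exact .impR (.botL (by simp))
  | mp _ _ ih1 ih2 => exact mp hS ih1 ih2
  | dualAnd A =>
    refine .impR (.andL List.mem_cons_self (.dual (Δ := [A]) (B := A.neg) (.inl rfl)
      (by simp [BoxIn]) (by simp) ?_))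
    exact mp hS (A := A) (.ax (by simp [neg])) (.ax (by simp))
  | @monBox A B _ ih => exact .impR (.box (Δ := [A]) (.inl rfl) (by simp [BoxIn]) (dd ih))
  | @monDia A B _ ih =>
    exact .impR (.dia (Δ := []) (B := A) (.inl rfl) (by simp [BoxIn]) (by simp) (dd ih))
  | nBox h =>
    exact .box (Δ := []) (.inr (.inl ⟨rfl, h⟩)) (by simp [BoxIn]) (.impR (.ax (by simp)))
  | cBox A B h =>
    exact .impR (.andL List.mem_cons_self (.box (Δ := [A, B]) (.inr (.inr ⟨by simp, h⟩))
      (by simp [BoxIn]) (.andR (.ax (by simp)) (.ax (by simp)))))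
  | kDia A B h =>
    exact .impR (.impR (.dia (Δ := [A.imp B]) (B := A) (.inr h) (by simp [BoxIn]) (by simp)
      (mp hS (A := A) (.ax (by simp)) (.ax (by simp)))))
  | pDia h =>
    exact .serial (Δ := []) (.inl ⟨rfl, .inl h⟩) (by simp [BoxIn]) (.impR (.ax (by simp)))
  | dAx A h =>
    exact .impR (.serial (Δ := [A]) (.inr (.inl ⟨rfl, h⟩)) (by simp [BoxIn]) (.ax (by simp)))
  | tBox A h => exact .impR (.boxT h List.mem_cons_self (.ax (by simp)))
  | tDia A h => exact .impR (.diaT h (.ax (by simp)))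

end Der

/-- Derivability from hypotheses in the Hilbert system; modal rules apply to theorems only. -/
inductive WDer (S : LogicSpec) (Γ : List Formula) : Formula → Prop
  | hyp {A : Formula} : A ∈ Γ → WDer S Γ A
  | thm {A : Formula} : WProof S A → WDer S Γ A
  | mp {A B : Formula} : WDer S Γ (A.imp B) → WDer S Γ A → WDer S Γ B

namespace WDer

variable {S : LogicSpec}

theorem mp₂ {Γ : List Formula} {A B C : Formula} (h : WProof S (A.imp (B.imp C)))
    (hA : WDer S Γ A) (hB : WDer S Γ B) : WDer S Γ C :=
  .mp (.mp (.thm h) hA) hB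

theorem ded {Γ : List Formula} {A B : Formula} (h : WDer S (A :: Γ) B) : WDer S Γ (A.imp B) := by
  induction h with
  | hyp h =>
    obtain rfl | h := List.mem_cons.1 h
    · exact mp₂ (.ax2 _ (Formula.imp _ _) _) (.thm (.ax1 _ _)) (.thm (.ax1 _ bot))
    · exact .mp (.thm (.ax1 _ _)) (.hyp h)
  | thm h => exact .mp (.thm (.ax1 _ _)) (.thm h)
  | mp _ _ ih1 ih2 => exact mp₂ (.ax2 _ _ _) ih1 ih2

theorem wProof {A : Formula} (h : WDer S [] A) : WProof S A := by
  induction h with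
  | hyp h => cases h
  | thm h => exact h
  | mp _ _ ih1 ih2 => exact .mp ih1 ih2

theorem weaken {Γ Γ' : List Formula} {A : Formula} (h : WDer S Γ A) (s : Γ ⊆ Γ') :
    WDer S Γ' A := by
  induction h with
  | hyp h => exact .hyp (s h)
  | thm h => exact .thm h
  | mp _ _ ih1 ih2 => exact .mp ih1 ih2

theorem cut {Γ : List Formula} {A B : Formula} (h : WDer S Γ A) (h' : WDer S (A :: Γ) B) :
    WDer S Γ B := .mp h'.ded h

theorem boxK (hC : S.hasC = true) {Γ : List Formula} {A B : Formula}
    (h : WDer S Γ (A.imp B).box) (hA : WDer S Γ A.box) : WDer S Γ B.box :=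
  .mp (.thm (.monBox (wProof (ded (.mp (.mp (.thm (.andE1 _ _)) (.hyp List.mem_cons_self))
      (.mp (.thm (.andE2 _ _)) (.hyp List.mem_cons_self)))))))
    (.mp (.thm (.cBox _ _ hC)) (mp₂ (.andI _ _) h hA))

theorem box_cons {A C : Formula} {Γ Δ : List Formula} (hl : Δ = [] ∨ S.hasC = true)
    (hA : WDer S Γ A.box) (hb : BoxIn Δ Γ) (h : WDer S (A :: Δ) C) : WDer S Γ C.box := by
  induction Δ generalizing C with
  | nil => exact .mp (.thm (.monBox (wProof h.ded))) hA
  | cons B Δ ih =>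
    have hC := hl.resolve_left (by simp)
    have h' : WDer S (B :: A :: Δ) C := h.weaken (by intro; simp; tauto)
    exact boxK hC (ih (.inr hC) (fun D hD => hb D (List.mem_cons_of_mem _ hD)) h'.ded)
      (.hyp (hb B List.mem_cons_self))

theorem box {C : Formula} {Γ Δ : List Formula} (hl : S.BoxArity Δ.length) (hb : BoxIn Δ Γ)
    (h : WDer S Δ C) : WDer S Γ C.box := by
  cases Δ with
  | nil =>
    exact .mp (.thm (.monBox (.mp (.ax1 _ _) h.wProof))) (.thm (.nBox (by
      simpa [LogicSpec.BoxArity] using hl)))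
  | cons A Δ =>
    refine box_cons ?_ (.hyp (hb A List.mem_cons_self))
      (fun D hD => hb D (List.mem_cons_of_mem _ hD)) h
    cases Δ <;> simp_all [LogicSpec.BoxArity]

theorem dia {B C : Formula} {Γ Δ : List Formula} (hl : S.DiaArity Δ.length) (hb : BoxIn Δ Γ)
    (hB : WDer S Γ B.dia) (h : WDer S (B :: Δ) C) : WDer S Γ C.dia := by
  cases Δ with
  | nil => exact .mp (.thm (.monDia h.ded.wProof)) hB
  | cons A Δ =>
    have hC : S.hasC = true := by simpa [LogicSpec.DiaArity] using hl
    exact mp₂ (.kDia _ _ hC) (box_cons (.inr hC) (.hyp (hb A List.mem_cons_self))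
      (fun D hD => hb D (List.mem_cons_of_mem _ hD)) h.ded) hB

theorem botE {Γ : List Formula} (h : WDer S Γ bot) (D : Formula) : WDer S Γ D :=
  .mp (.thm (.botE D)) h

theorem dual {B : Formula} {Γ Δ : List Formula} (hl : S.BoxArity Δ.length) (hb : BoxIn Δ Γ)
    (hB : WDer S Γ B.dia) (h : WDer S (B :: Δ) bot) : WDer S Γ bot := by
  have hdn : WDer S [] (B.imp B.neg.neg) :=
    ded (ded (.mp (A := B) (.hyp (by simp [neg])) (.hyp (by simp))))
  exact .mp (.thm (.dualAnd B.neg)) (mp₂ (.andI _ _) (box hl hb h.ded)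
    (.mp (.thm (.monDia hdn.wProof)) hB))

theorem dia_top (hS : S.Regular) (h : S.hasP = true ∨ S.hasD = true) : WProof S top.dia := by
  by_cases hP : S.hasP = true
  · exact .pDia hP
  · have hD := h.resolve_left hP
    exact .mp (.dAx _ hD) (.nBox ((hS.serial hD).resolve_left hP))

theorem serial (hS : S.Regular) {C : Formula} {Γ Δ : List Formula}
    (hl : S.SerialArity Δ.length) (hb : BoxIn Δ Γ) (h : WDer S Δ C) : WDer S Γ C.dia := by
  cases Δ with
  | nil =>
    refine .mp (.thm (.monDia (.mp (.ax1 _ _) h.wProof))) (.thm (dia_top hS ?_))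
    simp [LogicSpec.SerialArity] at hl
    tauto
  | cons A Δ =>
    have hD : S.hasD = true := by
      simp [LogicSpec.SerialArity] at hl
      tauto
    refine .mp (.thm (.dAx _ hD)) (box_cons ?_ (.hyp (hb A List.mem_cons_self))
      (fun D hD => hb D (List.mem_cons_of_mem _ hD)) h)
    cases Δ <;> simp_all [LogicSpec.SerialArity]

theorem cons (hS : S.Regular) {Γ Δ : List Formula}
    (hl : S.ConsArity Δ.length) (hb : BoxIn Δ Γ) (h : WDer S Δ bot) : WDer S Γ bot := by
  match Δ, hl, hb, h with
  | [], _, _, h => exact h.weaken (List.nil_subset _)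
  | [A], hl, hb, h =>
    refine dual (Δ := [A]) (B := top) (.inl rfl) hb (.thm (dia_top hS ?_))
      (h.weaken (List.subset_cons_self _ _))
    simp [LogicSpec.ConsArity] at hl
    tauto
  | A :: B :: Δ, hl, hb, h =>
    have hD : S.hasD = true := by
      simp [LogicSpec.ConsArity] at hl
      tauto
    refine dual (Δ := B :: Δ) (B := A) ?_ (fun D hD => hb D (List.mem_cons_of_mem _ hD))
      (.mp (.thm (.dAx _ hD)) (.hyp (hb A List.mem_cons_self))) h
    simp [LogicSpec.ConsArity, LogicSpec.BoxArity] at hl ⊢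
    grind

theorem of_der (hS : S.Regular) {Γ : List Formula} {A : Formula} (h : Der S Γ A) :
    WDer S Γ A := by
  induction h with
  | ax h => exact .hyp h
  | botL h => exact botE (.hyp h) _
  | andR _ _ ih1 ih2 => exact mp₂ (.andI _ _) ih1 ih2
  | andL h _ ih =>
    exact .mp (.mp ih.ded.ded (.mp (.thm (.andE2 _ _)) (.hyp h)))
      (.mp (.thm (.andE1 _ _)) (.hyp h))
  | orR1 _ ih => exact .mp (.thm (.orI1 _ _)) ih
  | orR2 _ ih => exact .mp (.thm (.orI2 _ _)) ih
  | orL h _ _ ih1 ih2 => exact .mp (mp₂ (.orE _ _ _) ih1.ded ih2.ded) (.hyp h)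
  | impR _ ih => exact ih.ded
  | impL h _ _ ih1 ih2 => exact cut (.mp (.hyp h) ih1) ih2
  | box h1 h2 _ ih => exact box h1 h2 ih
  | dia h1 h2 h _ ih => exact dia h1 h2 (.hyp h) ih
  | dual h1 h2 h _ ih => exact botE (dual h1 h2 (.hyp h) ih) _
  | serial h1 h2 _ ih => exact serial hS h1 h2 ih
  | cons h1 h2 _ ih => exact botE (cons hS h1 h2 ih) _
  | boxT hT h _ ih => exact cut (.mp (.thm (.tBox _ hT)) (.hyp h)) ih
  | diaT hT _ ih => exact .mp (.thm (.tDia _ hT)) ih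

end WDer

theorem bot_mem_varOf (A : Formula) : bot ∈ varOf A := by
  induction A <;> simp_all [varOf]

theorem mem_varM_coe {x : Formula} {Γ : List Formula} :
    x ∈ varM (Γ : Multiset Formula) ↔ x = bot ∨ ∃ B ∈ Γ, x ∈ varOf B := by
  simp [varM]

theorem varM_cons (A : Formula) (Γ : List Formula) :
    varM ((A :: Γ : List Formula) : Multiset Formula) = varOf A ∪ varM (Γ : Multiset Formula) := by
  ext x
  have := bot_mem_varOf A
  simp only [mem_varM_coe, Set.mem_union, List.mem_cons]
  grind

theorem varOf_subset_varM {A : Formula} {Γ : List Formula} (h : A ∈ Γ) :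
    varOf A ⊆ varM (Γ : Multiset Formula) :=
  fun _ hx => mem_varM_coe.2 (.inr ⟨A, h, hx⟩)

theorem varM_subset_of_boxIn {Δ Γ : List Formula} (h : BoxIn Δ Γ) :
    varM (Δ : Multiset Formula) ⊆ varM (Γ : Multiset Formula) := by
  intro x hx
  obtain rfl | ⟨B, hB, hx⟩ := mem_varM_coe.1 hx
  · exact mem_varM_coe.2 (.inl rfl)
  · exact mem_varM_coe.2 (.inr ⟨_, h B hB, hx⟩)

/-- `I` interpolates the partitioned sequent `Γ₁; Γ₂ ⇒ D`. -/
structure Interpolates (S : LogicSpec) (Γ₁ Γ₂ : List Formula) (D I : Formula) : Prop where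
  left : Der S Γ₁ I
  right : Der S (I :: Γ₂) D
  var_left : varOf I ⊆ varM (Γ₁ : Multiset Formula)
  var_right : varOf I ⊆ varM (Γ₂ : Multiset Formula) ∪ varOf D

/-- Every formula of `Γ` belongs to one of the parts `Γ₁`, `Γ₂`. -/
abbrev SplitsInto (Γ Γ₁ Γ₂ : List Formula) : Prop := ∀ A ∈ Γ, A ∈ Γ₁ ∨ A ∈ Γ₂

namespace SplitsInto

variable {Γ Γ₁ Γ₂ : List Formula}

theorem symm (h : SplitsInto Γ Γ₁ Γ₂) : SplitsInto Γ Γ₂ Γ₁ := fun A hA => (h A hA).symm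

theorem left (h : SplitsInto Γ Γ₁ Γ₂) (A : Formula) : SplitsInto (A :: Γ) (A :: Γ₁) Γ₂ := by
  intro B hB
  have := h B
  grind

theorem right (h : SplitsInto Γ Γ₁ Γ₂) (A : Formula) : SplitsInto (A :: Γ) Γ₁ (A :: Γ₂) :=
  (h.symm.left A).symm

theorem boxIn (h : SplitsInto Γ Γ₁ Γ₂) {Δ : List Formula} (hb : BoxIn Δ Γ) :
    ∃ Δ₁ Δ₂, SplitsInto Δ Δ₁ Δ₂ ∧ BoxIn Δ₁ Γ₁ ∧ BoxIn Δ₂ Γ₂ ∧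
      Δ.length = Δ₁.length + Δ₂.length := by
  induction Δ with
  | nil => exact ⟨[], [], by simp [SplitsInto, BoxIn]⟩
  | cons A Δ ih =>
    obtain ⟨Δ₁, Δ₂, h1, h2, h3, h4⟩ := ih fun B hB => hb B (List.mem_cons_of_mem _ hB)
    obtain hA | hA := h _ (hb A List.mem_cons_self)
    · exact ⟨A :: Δ₁, Δ₂, h1.left A, List.forall_mem_cons.2 ⟨hA, h2⟩, h3, by simp; omega⟩
    · exact ⟨Δ₁, A :: Δ₂, h1.right A, h2, List.forall_mem_cons.2 ⟨hA, h3⟩, by simp; omega⟩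

theorem subset_of_left_nil (h : SplitsInto Γ [] Γ₂) : Γ ⊆ Γ₂ :=
  fun A hA => (h A hA).resolve_left List.not_mem_nil

theorem subset_of_right_nil (h : SplitsInto Γ Γ₁ []) : Γ ⊆ Γ₁ := h.symm.subset_of_left_nil

end SplitsInto

namespace Interpolates

variable {S : LogicSpec} {Γ₁ Γ₂ : List Formula} {D : Formula}

theorem top (h : Der S Γ₂ D) : Interpolates S Γ₁ Γ₂ D top where
  left := .impR (.ax List.mem_cons_self)
  right := h.weaken (List.subset_cons_self _ _)
  var_left := by simp [Formula.top, varOf, varM]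
  var_right := by simp [Formula.top, varOf, varM]

theorem bot (h : Der S Γ₁ bot) : Interpolates S Γ₁ Γ₂ D bot where
  left := h
  right := .botL List.mem_cons_self
  var_left := by simp [varOf, varM]
  var_right := by simp [varOf, varM]

end Interpolates

theorem Der.cons_swap {S : LogicSpec} {A B D : Formula} {Γ : List Formula}
    (h : Der S (A :: B :: Γ) D) : Der S (B :: A :: Γ) D :=
  h.weaken (List.Perm.swap _ _ _).subset

theorem boxIn_box_cons {A : Formula} {Δ Γ : List Formula} (h : BoxIn Δ Γ) :
    BoxIn (A :: Δ) (A.box :: Γ) :=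
  List.forall_mem_cons.2 ⟨List.mem_cons_self, fun B hB => List.mem_cons_of_mem _ (h B hB)⟩

section arities

variable {S : LogicSpec} {a b : ℕ}

theorem LogicSpec.BoxArity.split (h : S.BoxArity (a + 1 + b)) :
    S.BoxArity (a + 1) ∧ S.BoxArity (b + 1) := by
  unfold BoxArity at *
  grind

theorem LogicSpec.BoxArity.split_dia (h : S.BoxArity (a + (b + 1))) :
    S.DiaArity a ∧ S.BoxArity (b + 1) := by
  unfold BoxArity DiaArity at *
  grind

theorem LogicSpec.DiaArity.split_left (h : S.DiaArity (a + b)) :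
    S.DiaArity a ∧ S.DiaArity b := by
  unfold DiaArity at *
  grind

theorem LogicSpec.DiaArity.split (h : S.DiaArity (a + 1 + b)) :
    S.BoxArity (a + 1) ∧ S.DiaArity (b + 1) := by
  unfold BoxArity DiaArity at *
  grind

theorem LogicSpec.SerialArity.split (h : S.SerialArity (a + 1 + b)) :
    S.BoxArity (a + 1) ∧ S.SerialArity (b + 1) := by
  unfold BoxArity SerialArity at *
  grind

theorem LogicSpec.ConsArity.split (h : S.ConsArity (a + 1 + (b + 1))) :
    S.BoxArity (a + 1) ∧ S.ConsArity (b + 1 + 1) := by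
  unfold BoxArity ConsArity at *
  grind

end arities

theorem Der.interpolation {S : LogicSpec} {Γ : List Formula} {D : Formula}
    (h : Der S Γ D) :
    ∀ {Γ₁ Γ₂ : List Formula}, SplitsInto Γ Γ₁ Γ₂ → ∃ I, Interpolates S Γ₁ Γ₂ D I := by
  induction h with
  | @ax Γ A h =>
    intro Γ₁ Γ₂ s
    obtain h | h := s _ h
    · exact ⟨A, .ax h, .ax List.mem_cons_self, varOf_subset_varM h, Set.subset_union_right⟩
    · exact ⟨_, .top (.ax h)⟩
  | botL h =>
    intro Γ₁ Γ₂ s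
    obtain h | h := s _ h
    · exact ⟨_, .bot (.botL h)⟩
    · exact ⟨_, .top (.botL h)⟩
  | @andR Γ A B _ _ ih1 ih2 =>
    intro Γ₁ Γ₂ s
    obtain ⟨I, l1, r1, v1, w1⟩ := ih1 s
    obtain ⟨J, l2, r2, v2, w2⟩ := ih2 s
    refine ⟨I.and J, .andR l1 l2, .andL List.mem_cons_self (.andR ?_ ?_), ?_, ?_⟩
    · exact r1.weaken (by intro; simp; tauto)
    · exact r2.weaken (by intro; simp; tauto)
    · simp only [varOf, Set.subset_def, Set.mem_union] at *
      grind
    · simp only [varOf, Set.subset_def, Set.mem_union] at *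
      grind
  | @andL Γ A B D h _ ih =>
    intro Γ₁ Γ₂ s
    obtain h | h := s _ h
    · obtain ⟨I, l, r, v, w⟩ := ih ((s.left B).left A)
      have hv := varOf_subset_varM h
      simp only [varM_cons, varOf, Set.subset_def, Set.mem_union] at v hv
      exact ⟨I, .andL h l, r, fun x hx => by grind, w⟩
    · obtain ⟨I, l, r, v, w⟩ := ih ((s.right B).right A)
      have hv := varOf_subset_varM h
      simp only [varM_cons, varOf, Set.subset_def, Set.mem_union] at w hv
      refine ⟨I, l, .andL (List.mem_cons_of_mem _ h) (r.weaken ?_), v, fun x hx => ?_⟩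
      · intro; simp; tauto
      · simp only [Set.mem_union]
        grind
  | orR1 _ ih =>
    intro Γ₁ Γ₂ s
    obtain ⟨I, l, r, v, w⟩ := ih s
    exact ⟨I, l, .orR1 r, v, w.trans (Set.union_subset_union_right _ Set.subset_union_left)⟩
  | orR2 _ ih =>
    intro Γ₁ Γ₂ s
    obtain ⟨I, l, r, v, w⟩ := ih s
    exact ⟨I, l, .orR2 r, v, w.trans (Set.union_subset_union_right _ Set.subset_union_right)⟩
  | @orL Γ A B D h _ _ ih1 ih2 =>
    intro Γ₁ Γ₂ s
    obtain h | h := s _ h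
    · obtain ⟨I, l1, r1, v1, w1⟩ := ih1 (s.left A)
      obtain ⟨J, l2, r2, v2, w2⟩ := ih2 (s.left B)
      have hv := varOf_subset_varM h
      refine ⟨I.or J, .orL h (.orR1 l1) (.orR2 l2), .orL List.mem_cons_self ?_ ?_, ?_, ?_⟩
      · exact r1.weaken (List.cons_subset_cons _ (List.subset_cons_self _ _))
      · exact r2.weaken (List.cons_subset_cons _ (List.subset_cons_self _ _))
      · simp only [varM_cons, varOf, Set.subset_def, Set.mem_union] at *
        grind
      · exact Set.union_subset w1 w2
    · obtain ⟨I, l1, r1, v1, w1⟩ := ih1 (s.right A)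
      obtain ⟨J, l2, r2, v2, w2⟩ := ih2 (s.right B)
      have hv := varOf_subset_varM h
      refine ⟨I.and J, .andR l1 l2, .andL List.mem_cons_self (.orL (A := A) (B := B) ?_ ?_ ?_),
        Set.union_subset v1 v2, ?_⟩
      · simp [h]
      · exact r1.weaken (by intro; simp; tauto)
      · exact r2.weaken (by intro; simp; tauto)
      · simp only [varM_cons, varOf, Set.subset_def, Set.mem_union] at *
        grind
  | @impR Γ A B _ ih =>
    intro Γ₁ Γ₂ s
    obtain ⟨I, l, r, v, w⟩ := ih (s.right A)
    refine ⟨I, l, .impR r.cons_swap, v, ?_⟩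
    simp only [varM_cons, varOf, Set.subset_def, Set.mem_union] at *
    grind
  | @impL Γ A B D h _ _ ih1 ih2 =>
    intro Γ₁ Γ₂ s
    obtain h | h := s _ h
    · obtain ⟨I, l1, r1, v1, w1⟩ := ih1 s.symm
      obtain ⟨J, l2, r2, v2, w2⟩ := ih2 (s.left B)
      have hv := varOf_subset_varM h
      refine ⟨I.imp J, .impR (.impL (List.mem_cons_of_mem _ h) r1 ?_),
        .impL List.mem_cons_self ?_ ?_, ?_, ?_⟩
      · exact l2.weaken (List.cons_subset_cons _ (List.subset_cons_self _ _))
      · exact l1.weaken (List.subset_cons_self _ _)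
      · exact r2.weaken (List.cons_subset_cons _ (List.subset_cons_self _ _))
      · simp only [varM_cons, varOf, Set.subset_def, Set.mem_union] at *
        grind
      · simp only [varM_cons, varOf, Set.subset_def, Set.mem_union] at *
        grind
    · obtain ⟨I, l1, r1, v1, w1⟩ := ih1 s
      obtain ⟨J, l2, r2, v2, w2⟩ := ih2 (s.right B)
      have hv := varOf_subset_varM h
      refine ⟨I.and J, .andR l1 l2, .andL List.mem_cons_self (.impL (A := A) (B := B) ?_ ?_ ?_),
        Set.union_subset v1 v2, ?_⟩
      · simp [h]
      · exact r1.weaken (by intro; simp; tauto)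
      · exact r2.weaken (by intro; simp; tauto)
      · simp only [varM_cons, varOf, Set.subset_def, Set.mem_union] at *
        grind
  | box h1 h2 h3 ih =>
    intro Γ₁ Γ₂ s
    obtain ⟨Δ₁, Δ₂, sΔ, b1, b2, hl⟩ := s.boxIn h2
    rw [hl] at h1
    obtain _ | ⟨A, Δ₁⟩ := Δ₁
    · exact ⟨_, .top (.box (by simpa using h1) b2 (h3.weaken sΔ.subset_of_left_nil))⟩
    · obtain ⟨I, l, r, v, w⟩ := ih sΔ
      obtain ⟨a1, a2⟩ := h1.split
      exact ⟨I.box, .box (Δ := A :: Δ₁) a1 b1 l,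
          .box (Δ := I :: Δ₂) a2 (boxIn_box_cons b2) r,
        v.trans (varM_subset_of_boxIn b1),
        w.trans (Set.union_subset_union_left _ (varM_subset_of_boxIn b2))⟩
  | @dia Γ Δ B C h1 h2 h h3 ih =>
    intro Γ₁ Γ₂ s
    obtain ⟨Δ₁, Δ₂, sΔ, b1, b2, hl⟩ := s.boxIn h2
    rw [hl] at h1
    have v1 := varM_subset_of_boxIn b1
    have v2 := varM_subset_of_boxIn b2
    obtain h | h := s _ h
    · obtain ⟨I, l, r, v, w⟩ := ih (sΔ.left B)
      obtain ⟨a1, a2⟩ := h1.split_left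
      refine ⟨I.dia, .dia a1 b1 h l,
        .dia a2 (Der.boxIn_mono b2 (List.subset_cons_self _ _)) List.mem_cons_self r, ?_,
        w.trans (Set.union_subset_union_left _ v2)⟩
      rw [varM_cons] at v
      exact v.trans (Set.union_subset (varOf_subset_varM (A := B.dia) h) v1)
    · obtain _ | ⟨A, Δ₁⟩ := Δ₁
      · exact ⟨_, .top (.dia (by simpa using h1) b2 h
          (h3.weaken (List.cons_subset_cons _ sΔ.subset_of_left_nil)))⟩
      · obtain ⟨I, l, r, v, w⟩ := ih (sΔ.right B)
        obtain ⟨a1, a2⟩ := h1.split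
        refine ⟨I.box, .box (Δ := A :: Δ₁) a1 b1 l,
          .dia (Δ := I :: Δ₂) a2 (boxIn_box_cons b2)
            (List.mem_cons_of_mem _ h) r.cons_swap, v.trans v1, ?_⟩
        rw [varM_cons] at w
        exact w.trans (Set.union_subset_union_left _
          (Set.union_subset (varOf_subset_varM (A := B.dia) h) v2))
  | @dual Γ Δ B D h1 h2 h h3 ih =>
    intro Γ₁ Γ₂ s
    obtain ⟨Δ₁, Δ₂, sΔ, b1, b2, hl⟩ := s.boxIn h2
    rw [hl] at h1
    have v1 := varM_subset_of_boxIn b1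
    have v2 := varM_subset_of_boxIn b2
    have hbot : varOf bot ⊆ varOf D := by simpa [varOf] using bot_mem_varOf D
    obtain h | h := s _ h
    · obtain _ | ⟨A, Δ₂⟩ := Δ₂
      · exact ⟨_, .bot (.dual (by simpa using h1) b1 h
          (h3.weaken (List.cons_subset_cons _ sΔ.subset_of_right_nil)))⟩
      · obtain ⟨I, l, r, v, w⟩ := ih (sΔ.left B)
        obtain ⟨a1, a2⟩ := h1.split_dia
        refine ⟨I.dia, .dia a1 b1 h l,
          .dual (Δ := A :: Δ₂) a2 (Der.boxIn_mono b2 (List.subset_cons_self _ _))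
            List.mem_cons_self r, ?_,
          w.trans (Set.union_subset_union v2 hbot)⟩
        rw [varM_cons] at v
        exact v.trans (Set.union_subset (varOf_subset_varM (A := B.dia) h) v1)
    · obtain _ | ⟨A, Δ₁⟩ := Δ₁
      · exact ⟨_, .top (.dual (by simpa using h1) b2 h
          (h3.weaken (List.cons_subset_cons _ sΔ.subset_of_left_nil)))⟩
      · obtain ⟨I, l, r, v, w⟩ := ih (sΔ.right B)
        obtain ⟨a1, a2⟩ := h1.split
        refine ⟨I.box, .box (Δ := A :: Δ₁) a1 b1 l,
          .dual (Δ := I :: Δ₂) a2 (boxIn_box_cons b2)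
            (List.mem_cons_of_mem _ h) r.cons_swap, v.trans v1, ?_⟩
        rw [varM_cons] at w
        exact w.trans (Set.union_subset_union
          (Set.union_subset (varOf_subset_varM (A := B.dia) h) v2) hbot)
  | serial h1 h2 h3 ih =>
    intro Γ₁ Γ₂ s
    obtain ⟨Δ₁, Δ₂, sΔ, b1, b2, hl⟩ := s.boxIn h2
    rw [hl] at h1
    obtain _ | ⟨A, Δ₁⟩ := Δ₁
    · exact ⟨_, .top (.serial (by simpa using h1) b2 (h3.weaken sΔ.subset_of_left_nil))⟩
    · obtain ⟨I, l, r, v, w⟩ := ih sΔ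
      obtain ⟨a1, a2⟩ := h1.split
      exact ⟨I.box, .box (Δ := A :: Δ₁) a1 b1 l,
          .serial (Δ := I :: Δ₂) a2 (boxIn_box_cons b2) r,
        v.trans (varM_subset_of_boxIn b1),
        w.trans (Set.union_subset_union_left _ (varM_subset_of_boxIn b2))⟩
  | @cons Γ Δ D h1 h2 h3 ih =>
    intro Γ₁ Γ₂ s
    obtain ⟨Δ₁, Δ₂, sΔ, b1, b2, hl⟩ := s.boxIn h2
    rw [hl] at h1
    have hbot : varOf bot ⊆ varOf D := by simpa [varOf] using bot_mem_varOf D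
    obtain _ | ⟨A, Δ₁⟩ := Δ₁
    · exact ⟨_, .top (.cons (by simpa using h1) b2 (h3.weaken sΔ.subset_of_left_nil))⟩
    · obtain _ | ⟨B, Δ₂⟩ := Δ₂
      · exact ⟨_, .bot (.cons (by simpa using h1) b1 (h3.weaken sΔ.subset_of_right_nil))⟩
      · obtain ⟨I, l, r, v, w⟩ := ih sΔ
        obtain ⟨a1, a2⟩ := h1.split
        exact ⟨I.box, .box (Δ := A :: Δ₁) a1 b1 l,
          .cons (Δ := I :: B :: Δ₂) a2 (boxIn_box_cons b2) r,
          v.trans (varM_subset_of_boxIn b1),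
          w.trans (Set.union_subset_union (varM_subset_of_boxIn b2) hbot)⟩
  | @boxT Γ A D hT h _ ih =>
    intro Γ₁ Γ₂ s
    obtain h | h := s _ h
    · obtain ⟨I, l, r, v, w⟩ := ih (s.left A)
      rw [varM_cons] at v
      exact ⟨I, .boxT hT h l, r,
        v.trans (Set.union_subset (varOf_subset_varM (A := A.box) h) subset_rfl), w⟩
    · obtain ⟨I, l, r, v, w⟩ := ih (s.right A)
      rw [varM_cons] at w
      exact ⟨I, l, .boxT hT (List.mem_cons_of_mem _ h) r.cons_swap, v,
        w.trans (Set.union_subset_union_left _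
          (Set.union_subset (varOf_subset_varM (A := A.box) h) subset_rfl))⟩
  | diaT hT _ ih =>
    intro Γ₁ Γ₂ s
    obtain ⟨I, l, r, v, w⟩ := ih s
    exact ⟨I, l, .diaT hT r, v, w⟩

/-- every W-logic among the fourteen enjoys Craig interpolation. -/
theorem statement12 (L : LName) (A B : Formula) :
    WProof (wSpec L) (A.imp B) →
    ∃ C : Formula, WProof (wSpec L) (A.imp C) ∧ WProof (wSpec L) (C.imp B) ∧
      varOf C ⊆ varOf A ∩ varOf B := by
  intro h
  have hS := wSpec_regular L
  have hAB : Der (wSpec L) [A] B :=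
    Der.mp hS ((Der.of_wProof hS h).weaken (List.nil_subset _)) (.ax List.mem_cons_self)
  obtain ⟨C, l, r, v, w⟩ := hAB.interpolation (Γ₁ := [A]) (Γ₂ := []) fun _ => .inl
  refine ⟨C, (WDer.of_der hS l).ded.wProof, (WDer.of_der hS r).ded.wProof,
    Set.subset_inter (fun x hx => ?_) (fun x hx => ?_)⟩
  · have := bot_mem_varOf A
    have := mem_varM_coe.1 (v hx)
    grind
  · have := bot_mem_varOf B
    have := w hx
    simp only [Set.mem_union, mem_varM_coe] at this
    grind
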